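/- Let S be a C-semigroup in ℕ^d with full cone, let ≺ be a term order on ℕ^d such that every element of ℕ^d is preceded by only finitely many elements, and suppose S is ≺-almost symmetric. If 2·|{g ∈ S : g ≺ F(S)_≺}| + |PF(S)| ≤ e(S)·|{g ∈ S : g ≺ F(S)_≺}|, then S satisfies the extended Wilf inequality: |{g ∈ S : g ≺ F(S)_≺}|·e(S) ≥ N(F(S)_≺) + 1, where N(F(S)_≺) = |H(S)| + |{g ∈ S : g ≺ F(S)_≺}|. -/

import Mathlib

open Set

/-- Membership in the rational cone spanned by `S` inside `ℚ^d`. -/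
def memCone {d : ℕ} (S : Set (Fin d → ℕ)) (x : Fin d → ℚ) : Prop :=
  ∃ (n : ℕ) (c : Fin n → ℚ) (v : Fin n → (Fin d → ℕ)),
    (∀ i, 0 ≤ c i) ∧ (∀ i, v i ∈ S) ∧ x = ∑ i, c i • (fun j => ((v i j : ℚ)))

/-- `cone(S) ∩ ℕ^d`, viewed as a subset of `ℕ^d`. -/
def coneN {d : ℕ} (S : Set (Fin d → ℕ)) : Set (Fin d → ℕ) :=
  {x | memCone S (fun j => ((x j : ℚ)))}

/-- `H(S) = (cone(S) \ S) ∩ ℕ^d`. -/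
def Hset {d : ℕ} (S : Set (Fin d → ℕ)) : Set (Fin d → ℕ) := coneN S \ S

/-- The set of pseudo-Frobenius elements of `S`. -/
def pfSet {d : ℕ} (S : Set (Fin d → ℕ)) : Set (Fin d → ℕ) :=
  {f | f ∈ Hset S ∧ ∀ s ∈ S, s ≠ 0 → f + s ∈ S}

/-- A term order on `ℕ^d`: a strict total order compatible with addition. -/
def IsTermOrder {d : ℕ} (prec : (Fin d → ℕ) → (Fin d → ℕ) → Prop) : Prop :=
  (∀ a, ¬ prec a a) ∧ (∀ a b c, prec a b → prec b c → prec a c) ∧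
    (∀ a b, a ≠ b → prec a b ∨ prec b a) ∧
    (∀ a b c, prec a b → prec (a + c) (b + c))

/-- `F` is the maximum of `H(S)` with respect to the term order `prec`. -/
def IsFrob {d : ℕ} (S : Set (Fin d → ℕ)) (prec : (Fin d → ℕ) → (Fin d → ℕ) → Prop)
    (F : Fin d → ℕ) : Prop :=
  F ∈ Hset S ∧ ∀ h ∈ Hset S, h ≠ F → prec h F

/-- A `C`-semigroup: a finitely generated submonoid of `ℕ^d` with
`H(S)` nonempty and finite. -/
def CSemigroup {d : ℕ} (S : AddSubmonoid (Fin d → ℕ)) : Prop :=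
  S.FG ∧ (Hset (S : Set (Fin d → ℕ))).Nonempty ∧ (Hset (S : Set (Fin d → ℕ))).Finite

/-- `T` is an ideal of `S`: a subset of `cone(S) ∩ ℕ^d` with `S + T ⊆ T`. -/
def IsIdeal {d : ℕ} (S T : Set (Fin d → ℕ)) : Prop :=
  T ⊆ coneN S ∧ ∀ s ∈ S, ∀ t ∈ T, s + t ∈ T

/-- `Ω_≺ = {z ∈ cone(S) ∩ ℕ^d : F(S)_≺ − z ∉ S}` (the condition `F − z ∉ S`
is expressed as: there is no `w ∈ S` with `z + w = F`). -/
def omegaSet {d : ℕ} (S : Set (Fin d → ℕ)) (F : Fin d → ℕ) : Set (Fin d → ℕ) :=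
  {z ∈ coneN S | ¬ ∃ w ∈ S, z + w = F}

/-- `S` is `≺`-almost symmetric (with Frobenius element `F`):
`PF'(S) = PF(S) \ {F}` is nonempty and `F − g ∈ PF'(S)` for every `g ∈ PF'(S)`. -/
def AlmostSym {d : ℕ} (S : Set (Fin d → ℕ)) (F : Fin d → ℕ) : Prop :=
  (pfSet S \ {F}).Nonempty ∧ ∀ g ∈ pfSet S \ {F}, ∃ w ∈ pfSet S \ {F}, g + w = F

/-- The unique minimal generating set of a submonoid of `ℕ^d`:
the nonzero elements that are not sums of two nonzero elements. -/
def minGens {d : ℕ} (S : Set (Fin d → ℕ)) : Set (Fin d → ℕ) :=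
  {s ∈ S | s ≠ 0 ∧ ¬ ∃ x ∈ S, ∃ y ∈ S, x ≠ 0 ∧ y ≠ 0 ∧ x + y = s}

/-- In a term order with finite initial segments, `0` precedes every nonzero element. -/
theorem IsTermOrder.zero_prec {d : ℕ} {prec : (Fin d → ℕ) → (Fin d → ℕ) → Prop}
    (hprec : IsTermOrder prec) (hfin : {g | prec g 0}.Finite)
    {s : Fin d → ℕ} (hs : s ≠ 0) : prec 0 s := by
  obtain ⟨-, htrans, htotal, hadd⟩ := hprec
  refine (htotal 0 s hs.symm).resolve_right fun hneg => ?_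
  have hmul : ∀ k : ℕ, prec ((k + 1) • s) 0 := by
    intro k
    induction k with
    | zero => simpa using hneg
    | succ k ih =>
      have hstep := hadd _ _ s ih
      rw [zero_add, ← succ_nsmul] at hstep
      exact htrans _ _ _ hstep hneg
  obtain ⟨i, hi⟩ := Function.ne_iff.mp hs
  have hinj : Function.Injective fun k : ℕ => (k + 1) • s := by
    intro a b hab
    have hab_i : (a + 1) * s i = (b + 1) * s i := by simpa using congrFun hab i
    exact Nat.succ_injective (Nat.eq_of_mul_eq_mul_right (Nat.pos_of_ne_zero hi) hab_i)
  exact Set.infinite_of_injective_forall_mem hinj hmul hfin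

/-- Every gap of a submonoid with full cone and finitely many gaps lies below a
pseudo-Frobenius element. -/
theorem exists_add_mem_pfSet {d : ℕ} {S : AddSubmonoid (Fin d → ℕ)}
    (hfull : coneN (S : Set (Fin d → ℕ)) = Set.univ)
    (hH : (Hset (S : Set (Fin d → ℕ))).Finite)
    {z : Fin d → ℕ} (hz : z ∈ Hset (S : Set (Fin d → ℕ))) :
    ∃ s ∈ S, z + s ∈ pfSet (S : Set (Fin d → ℕ)) := by
  obtain ⟨m, ⟨hmH, s, hs, rfl⟩, hmax⟩ :=
    (hH.subset fun x (hx : x ∈ Hset (S : Set (Fin d → ℕ)) ∧ ∃ s ∈ S, z + s = x) => hx.1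
      ).exists_maximal ⟨z, hz, 0, S.zero_mem, add_zero z⟩
  refine ⟨s, hs, hmH, fun t ht ht0 => ?_⟩
  by_contra hnot
  have hle := hmax (y := z + s + t)
    ⟨⟨hfull ▸ Set.mem_univ _, hnot⟩, s + t, S.add_mem hs ht, (add_assoc z s t).symm⟩
    le_self_add
  exact ht0 (add_eq_left.mp (le_antisymm hle le_self_add))

/-- In an almost symmetric semigroup, a gap not complemented to `F` by an element of `S` is a
pseudo-Frobenius element other than `F`. -/
theorem AlmostSym.mem_pfSet_diff {d : ℕ} {S : AddSubmonoid (Fin d → ℕ)} {F : Fin d → ℕ}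
    (hAS : AlmostSym (S : Set (Fin d → ℕ)) F)
    (hfull : coneN (S : Set (Fin d → ℕ)) = Set.univ)
    (hH : (Hset (S : Set (Fin d → ℕ))).Finite)
    {z : Fin d → ℕ} (hz : z ∈ Hset (S : Set (Fin d → ℕ))) (hzF : ¬ ∃ w ∈ S, z + w = F) :
    z ∈ pfSet (S : Set (Fin d → ℕ)) \ {F} := by
  obtain ⟨s, hs, hpf⟩ := exists_add_mem_pfSet hfull hH hz
  have hmem : z + s ∈ pfSet (S : Set (Fin d → ℕ)) \ {F} := ⟨hpf, fun heq => hzF ⟨s, hs, heq⟩⟩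
  obtain ⟨w, hw, hsum⟩ := hAS.2 _ hmem
  rcases eq_or_ne s 0 with rfl | hs0
  · simpa using hmem
  · exact absurd ⟨w + s, hw.1.2 s hs hs0, by rw [← hsum]; abel⟩ hzF

/-- Let `S` be a `≺`-almost symmetric `C`-semigroup with full cone,
where every element of `ℕ^d` is preceded by only finitely many elements. If
`2·|{g ∈ S : g ≺ F}| + |PF(S)| ≤ e(S)·|{g ∈ S : g ≺ F}|`, then `S` satisfies the
extended Wilf inequality `|{g ∈ S : g ≺ F}|·e(S) ≥ |H(S)| + |{g ∈ S : g ≺ F}| + 1`. -/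
theorem wilf_sufficient {d : ℕ} (S : AddSubmonoid (Fin d → ℕ)) (hC : CSemigroup S)
    (hfull : coneN (S : Set (Fin d → ℕ)) = Set.univ)
    (prec : (Fin d → ℕ) → (Fin d → ℕ) → Prop) (hprec : IsTermOrder prec)
    (hfin : ∀ x : Fin d → ℕ, {g | prec g x}.Finite)
    (F : Fin d → ℕ) (hF : IsFrob (S : Set (Fin d → ℕ)) prec F)
    (hAS : AlmostSym (S : Set (Fin d → ℕ)) F)
    (h : 2 * {g ∈ (S : Set (Fin d → ℕ)) | prec g F}.ncard +
          (pfSet (S : Set (Fin d → ℕ))).ncard ≤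
        (minGens (S : Set (Fin d → ℕ))).ncard *
          {g ∈ (S : Set (Fin d → ℕ)) | prec g F}.ncard) :
    (Hset (S : Set (Fin d → ℕ))).ncard +
        {g ∈ (S : Set (Fin d → ℕ)) | prec g F}.ncard + 1 ≤
      {g ∈ (S : Set (Fin d → ℕ)) | prec g F}.ncard *
        (minGens (S : Set (Fin d → ℕ))).ncard := by
  obtain ⟨-, -, hHfin⟩ := hC
  have hzero : ∀ s : Fin d → ℕ, s ≠ 0 → prec 0 s := fun s => hprec.zero_prec (hfin 0)
  set A := {g ∈ (S : Set (Fin d → ℕ)) | prec g F}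
  have hAfin : A.Finite := (hfin F).subset fun g hg => hg.2
  have hPFfin : (pfSet (S : Set (Fin d → ℕ))).Finite := hHfin.subset fun g hg => hg.1
  have hFpf : F ∈ pfSet (S : Set (Fin d → ℕ)) := by
    refine ⟨hF.1, fun s _ hs0 => ?_⟩
    by_contra hnot
    have hback := hF.2 (F + s) ⟨hfull ▸ Set.mem_univ _, hnot⟩ (by simpa using hs0)
    have hforth : prec F (F + s) := by simpa [add_comm] using hprec.2.2.2 _ _ F (hzero s hs0)
    exact hprec.1 _ (hprec.2.1 _ _ _ hback hforth)
  have hcover : Hset (S : Set (Fin d → ℕ)) ⊆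
      (fun w => F - w) '' A ∪ pfSet (S : Set (Fin d → ℕ)) \ {F} := by
    intro z hz
    by_cases hzF : ∃ w ∈ S, z + w = F
    · obtain ⟨w, hw, rfl⟩ := hzF
      have hz0 : z ≠ 0 := by rintro rfl; exact hz.2 S.zero_mem
      exact Or.inl ⟨w, ⟨hw, by simpa using hprec.2.2.2 _ _ w (hzero z hz0)⟩,
        add_tsub_cancel_right z w⟩
    · exact Or.inr (hAS.mem_pfSet_diff hfull hHfin hz hzF)
  have hbound : (Hset (S : Set (Fin d → ℕ))).ncard ≤
      A.ncard + (pfSet (S : Set (Fin d → ℕ)) \ {F}).ncard :=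
    (Set.ncard_le_ncard hcover ((hAfin.image _).union hPFfin.sdiff)).trans <|
      (Set.ncard_union_le _ _).trans <| Nat.add_le_add_right (Set.ncard_image_le hAfin) _
  have hPFcard := Set.ncard_sdiff_singleton_add_one hFpf hPFfin
  rw [mul_comm A.ncard]
  omega
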